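/- Let n and x be nonnegative integers. Then det( C(x+i+j+1, 2i-j) + C(x+i+j, 2i-j-1) )_{0≤i,j≤n-1} = ∏_{i=0}^{n-1} (x+3i+1) · ∏_{i=0}^{n-1} [ i! · (x+i)! · (2x+2i+2)_i · (x+2i+1)_i ] / [ (x+2i+1)! · (2i)! ]. -/

import Mathlib

open Finset

/-- Binomial coefficient `C(m,k)` for `m : ℕ` and `k : ℤ`, zero if `k < 0` or `k > m`. -/
def C (m : ℕ) (k : ℤ) : ℚ := if 0 ≤ k then (m.choose k.toNat : ℚ) else 0

/-- The shifted factorial (ascending Pochhammer): `(a)_k = a(a+1)⋯(a+k-1)`, as a rational. -/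
def asc (a k : ℕ) : ℚ := ∏ m ∈ Finset.range k, ((a : ℚ) + m)

namespace Matrix

variable {R m k : Type*} [CommRing R] [Fintype m] [DecidableEq m] [Fintype k] [DecidableEq k]

theorem det_mul_det_toBlocks₁₁_adjugate (A : Matrix (m ⊕ k) (m ⊕ k) R) :
    A.det * A.adjugate.toBlocks₁₁.det = A.det ^ Fintype.card m * A.toBlocks₂₂.det := by
  have hadj := A.mul_adjugate
  rw [← fromBlocks_toBlocks A.adjugate, ← fromBlocks_one, fromBlocks_smul, smul_zero] at hadj
  nth_rw 1 [← fromBlocks_toBlocks A] at hadj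
  rw [fromBlocks_multiply, fromBlocks_inj] at hadj
  obtain ⟨h₁, -, h₂, -⟩ := hadj
  have hmul : A * fromBlocks A.adjugate.toBlocks₁₁ 0 A.adjugate.toBlocks₂₁ 1 =
      fromBlocks (A.det • 1) A.toBlocks₁₂ 0 A.toBlocks₂₂ := by
    nth_rw 1 [← fromBlocks_toBlocks A]
    rw [fromBlocks_multiply, h₁, h₂]
    simp
  have hdet := congrArg det hmul
  rwa [det_mul, det_fromBlocks_zero₁₂, det_fromBlocks_zero₂₁, det_one, mul_one, det_smul,
    det_one, mul_one] at hdet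

/-- Jacobi's complementary minor formula for a principal block. -/
theorem det_toBlocks₁₁_adjugate [Nonempty m] (A : Matrix (m ⊕ k) (m ⊕ k) R) :
    A.adjugate.toBlocks₁₁.det = A.det ^ (Fintype.card m - 1) * A.toBlocks₂₂.det := by
  let A' := mvPolynomialX (m ⊕ k) (m ⊕ k) ℤ
  have key : A'.adjugate.toBlocks₁₁.det = A'.det ^ (Fintype.card m - 1) * A'.toBlocks₂₂.det := by
    apply mul_left_cancel₀ (show A'.det ≠ 0 from det_mvPolynomialX_ne_zero _ ℤ)
    rw [det_mul_det_toBlocks₁₁_adjugate, ← mul_assoc, ← pow_succ',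
      Nat.sub_add_cancel Fintype.card_pos]
  let φ := MvPolynomial.aeval (R := ℤ) fun p : (m ⊕ k) × (m ⊕ k) => A p.1 p.2
  have hA : φ.mapMatrix A' = A := mvPolynomialX_mapMatrix_aeval ℤ A
  have h₁₁ : A.adjugate.toBlocks₁₁ = φ.mapMatrix A'.adjugate.toBlocks₁₁ := by
    rw [← hA, ← AlgHom.map_adjugate]
    rfl
  have h₂₂ : A.toBlocks₂₂ = φ.mapMatrix A'.toBlocks₂₂ := by
    nth_rw 1 [← hA]
    rfl
  have hd : A.det = φ A'.det := by rw [AlgHom.map_det, hA]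
  rw [h₁₁, h₂₂, hd, ← AlgHom.map_det, ← AlgHom.map_det, key, map_mul, map_pow]

/-- The Desnanot–Jacobi identity (Dodgson condensation). -/
theorem det_mul_det_submatrix_inner {n : ℕ} (A : Matrix (Fin (n + 2)) (Fin (n + 2)) R) :
    A.det * (A.submatrix (fun i : Fin n => i.castSucc.succ) fun j => j.castSucc.succ).det =
      (A.submatrix Fin.succ Fin.succ).det * (A.submatrix Fin.castSucc Fin.castSucc).det -
        (A.submatrix Fin.succ Fin.castSucc).det * (A.submatrix Fin.castSucc Fin.succ).det := by
  let g : Fin 2 ⊕ Fin n → Fin (n + 2) :=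
    Sum.elim ![0, Fin.last (n + 1)] fun i => i.castSucc.succ
  have hg : Function.Bijective g := by
    rw [Fintype.bijective_iff_injective_and_card]
    refine ⟨?_, by simp [add_comm]⟩
    rintro (i | i) (j | j) h
    · fin_cases i <;> fin_cases j <;> simp_all [g, Fin.ext_iff]
    · have := j.isLt
      fin_cases i <;> simp [g, Fin.ext_iff] at h
      omega
    · have := i.isLt
      fin_cases j <;> simp [g, Fin.ext_iff] at h
      omega
    · simpa [g, Fin.ext_iff] using h
  let e := Equiv.ofBijective g hg
  have h := det_toBlocks₁₁_adjugate (A.submatrix e e)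
  rw [adjugate_submatrix_equiv_self, det_submatrix_equiv_self, det_fin_two] at h
  have h₂₂ : (A.submatrix e e).toBlocks₂₂ =
      A.submatrix (fun i : Fin n => i.castSucc.succ) fun j => j.castSucc.succ := rfl
  have he₀ : e (Sum.inl 0) = 0 := rfl
  have he₁ : e (Sum.inl 1) = Fin.last (n + 1) := rfl
  simp only [h₂₂, toBlocks₁₁, of_apply, submatrix_apply, he₀, he₁,
    adjugate_fin_succ_eq_det_submatrix, Fintype.card_fin, Nat.add_one_sub_one, pow_one] at h
  have hs : ((-1 : R) ^ (n + 1)) * (-1) ^ (n + 1) = 1 := by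
    rw [← mul_pow]
    simp
  have hs' : ((-1 : R) ^ (n + 1 + (n + 1))) = 1 := by rw [pow_add, hs]
  rw [← h]
  simp only [Fin.val_zero, Fin.val_last, Fin.succAbove_zero, Fin.succAbove_last, add_zero,
    zero_add, pow_zero, hs', one_mul]
  rw [mul_mul_mul_comm, hs, one_mul]
  exact congrArg _ (mul_comm _ _)

end Matrix

/-- The reciprocal of `k!`, extended by zero to negative integers. -/
def invFactorial (k : ℤ) : ℚ := if 0 ≤ k then (k.toNat.factorial : ℚ)⁻¹ else 0

theorem invFactorial_natCast (k : ℕ) : invFactorial k = (k.factorial : ℚ)⁻¹ := by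
  simp [invFactorial]

theorem invFactorial_of_neg {k : ℤ} (hk : k < 0) : invFactorial k = 0 :=
  if_neg hk.not_ge

/-- The Andrews–Burge type matrix with entries `(s+i+j)! / ((x+2i-j)! (y+2j-i)!)`. -/
def factorialMatrix (n s : ℕ) (x y : ℤ) : Matrix (Fin n) (Fin n) ℚ :=
  Matrix.of fun i j => ((s + i + j : ℕ).factorial : ℚ) *
    invFactorial (x + 2 * (i : ℕ) - (j : ℕ)) * invFactorial (y + 2 * (j : ℕ) - (i : ℕ))

theorem det_factorialMatrix_neg_one_left (n s : ℕ) (y : ℤ) :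
    (factorialMatrix (n + 1) s (-1) y).det = 0 := by
  apply Matrix.det_eq_zero_of_row_eq_zero 0
  intro j
  rw [factorialMatrix, Matrix.of_apply, invFactorial_of_neg (k := -1 + _ - _) (by simp; omega)]
  simp

theorem det_factorialMatrix_neg_one_right (n s : ℕ) (x : ℤ) :
    (factorialMatrix (n + 1) s x (-1)).det = 0 := by
  apply Matrix.det_eq_zero_of_column_eq_zero 0
  intro i
  rw [factorialMatrix, Matrix.of_apply, invFactorial_of_neg (k := -1 + _ - _) (by simp; omega)]
  simp

theorem submatrix_factorialMatrix {n N : ℕ} (s a b : ℕ) (x y : ℤ) {f g : Fin n → Fin N}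
    (hf : ∀ i, (f i : ℕ) = i + a) (hg : ∀ j, (g j : ℕ) = j + b) :
    (factorialMatrix N s x y).submatrix f g =
      factorialMatrix n (s + (a + b)) (x + (2 * a - b)) (y + (2 * b - a)) := by
  ext i j
  simp only [factorialMatrix, Matrix.of_apply, Matrix.submatrix_apply, hf, hg]
  rw [show s + (i + a) + (j + b) = s + (a + b) + i + j by ring,
    show x + 2 * ((i + a : ℕ) : ℤ) - ((j + b : ℕ) : ℤ) =
      x + (2 * a - b) + 2 * (i : ℕ) - (j : ℕ) by push_cast; ring,
    show y + 2 * ((j + b : ℕ) : ℤ) - ((i + a : ℕ) : ℤ) =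
      y + (2 * b - a) + 2 * (j : ℕ) - (i : ℕ) by push_cast; ring]

theorem det_factorialMatrix_condensation (n s : ℕ) (x y : ℤ) :
    (factorialMatrix (n + 2) s x y).det * (factorialMatrix n (s + 2) (x + 1) (y + 1)).det =
      (factorialMatrix (n + 1) (s + 2) (x + 1) (y + 1)).det * (factorialMatrix (n + 1) s x y).det -
        (factorialMatrix (n + 1) (s + 1) (x + 2) (y - 1)).det *
          (factorialMatrix (n + 1) (s + 1) (x - 1) (y + 2)).det := by
  have h := Matrix.det_mul_det_submatrix_inner (factorialMatrix (n + 2) s x y)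
  rw [submatrix_factorialMatrix s 1 1 x y (by simp) (by simp),
    submatrix_factorialMatrix s 1 1 x y (by simp) (by simp),
    submatrix_factorialMatrix s 0 0 x y (by simp) (by simp),
    submatrix_factorialMatrix s 1 0 x y (by simp) (by simp),
    submatrix_factorialMatrix s 0 1 x y (by simp) (by simp)] at h
  simpa [← sub_eq_add_neg] using h

theorem asc_succ (a k : ℕ) : asc a (k + 1) = a * asc (a + 1) k := by
  rw [asc, asc, prod_range_succ']
  simp only [Nat.cast_add, Nat.cast_zero, Nat.cast_one, add_zero]
  rw [mul_comm]
  congr 1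
  exact prod_congr rfl fun i _ => by ring

theorem asc_pos {a : ℕ} (ha : 0 < a) (k : ℕ) : 0 < asc a k := by
  apply prod_pos
  intros
  positivity

/-- The `i`-th factor in the evaluation of `det (factorialMatrix n s x y)`. -/
def detFactor (s x y i : ℕ) : ℚ :=
  (i.factorial * (s + i).factorial * asc (2 * x + y + 2 * i) i * asc (x + 2 * y + 2 * i) i) /
    ((x + 2 * i).factorial * (y + 2 * i).factorial)

theorem detFactor_pos {s x y : ℕ} (h : s + 1 = x + y) (i : ℕ) : 0 < detFactor s x y i := by
  have h₁ := asc_pos (a := 2 * x + y + 2 * i) (by omega) i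
  have h₂ := asc_pos (a := x + 2 * y + 2 * i) (by omega) i
  rw [detFactor]
  positivity

theorem detFactor_eq {s x y i p a b u v : ℕ} (hp : s + i = p) (ha : 2 * x + y + 2 * i = a)
    (hb : x + 2 * y + 2 * i = b) (hu : x + 2 * i = u) (hv : y + 2 * i = v) :
    detFactor s x y i =
      (i.factorial * p.factorial * asc a i * asc b i) / (u.factorial * v.factorial) := by
  subst hp ha hb hu hv
  rfl

/-- The quotient of the products evaluating the off-diagonal and central minors in the
condensation of `factorialMatrix (n + 2) s x y`. -/
def condensationRatio (s x y n : ℕ) : ℚ :=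
  (x * y * (s + 1) * n.factorial * (s + n + 1).factorial *
    asc (2 * x + y + 2 * n + 3) n * asc (x + 2 * y + 2 * n + 3) n) /
    ((x + 2 * n + 2).factorial * (y + 2 * n + 2).factorial)

theorem detFactor_sub_detFactor {s x y : ℕ} (h : s + 1 = x + y) (n : ℕ) :
    detFactor (s + 2) (x + 1) (y + 1) n - detFactor s x y (n + 1) = condensationRatio s x y n := by
  rw [detFactor_eq (p := s + n + 1 + 1) (a := 2 * x + y + 2 * n + 3)
      (b := x + 2 * y + 2 * n + 3) (u := x + 2 * n + 1) (v := y + 2 * n + 1)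
      (by omega) (by omega) (by omega) (by omega) (by omega),
    detFactor_eq (p := s + n + 1) (a := 2 * x + y + 2 * n + 2)
      (b := x + 2 * y + 2 * n + 2) (u := x + 2 * n + 1 + 1) (v := y + 2 * n + 1 + 1)
      (by omega) (by omega) (by omega) (by omega) (by omega),
    condensationRatio, asc_succ, asc_succ]
  simp only [Nat.factorial_succ (x + 2 * n + 1), Nat.factorial_succ (y + 2 * n + 1),
    Nat.factorial_succ (s + n + 1), Nat.factorial_succ n]
  have hs : (s : ℚ) = x + y - 1 := by
    rw [eq_sub_iff_add_eq]
    exact_mod_cast h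
  push_cast
  field_simp
  rw [hs]
  ring

theorem detFactor_mul_condensationRatio (x y n : ℕ) :
    detFactor (x + y + 2) (x + 3) y (n + 1) * detFactor (x + y + 2) x (y + 3) (n + 1) *
        condensationRatio (x + y + 1) (x + 1) (y + 1) n =
      condensationRatio (x + y + 1) (x + 1) (y + 1) (n + 1) *
        (detFactor (x + y + 1) (x + 1) (y + 1) (n + 1) *
          detFactor (x + y + 3) (x + 2) (y + 2) n) := by
  rw [detFactor_eq (p := x + y + n + 3) (a := 2 * x + y + 2 * n + 8)
      (b := x + 2 * y + 2 * n + 5) (u := x + 2 * n + 5) (v := y + 2 * n + 2)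
      (by omega) (by omega) (by omega) (by omega) (by omega),
    detFactor_eq (p := x + y + n + 3) (a := 2 * x + y + 2 * n + 5)
      (b := x + 2 * y + 2 * n + 8) (u := x + 2 * n + 2) (v := y + 2 * n + 5)
      (by omega) (by omega) (by omega) (by omega) (by omega),
    detFactor_eq (p := x + y + n + 2) (a := 2 * x + y + 2 * n + 5)
      (b := x + 2 * y + 2 * n + 5) (u := x + 2 * n + 3) (v := y + 2 * n + 3)
      (by omega) (by omega) (by omega) (by omega) (by omega),
    detFactor_eq (p := x + y + n + 3) (a := 2 * x + y + 2 * n + 6)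
      (b := x + 2 * y + 2 * n + 6) (u := x + 2 * n + 2) (v := y + 2 * n + 2)
      (by omega) (by omega) (by omega) (by omega) (by omega),
    condensationRatio, condensationRatio]
  rw [show x + y + 1 + n + 1 = x + y + n + 2 by omega,
    show x + y + 1 + (n + 1) + 1 = x + y + n + 3 by omega,
    show 2 * (x + 1) + (y + 1) + 2 * n + 3 = 2 * x + y + 2 * n + 6 by omega,
    show x + 1 + 2 * (y + 1) + 2 * n + 3 = x + 2 * y + 2 * n + 6 by omega,
    show 2 * (x + 1) + (y + 1) + 2 * (n + 1) + 3 = 2 * x + y + 2 * n + 8 by omega,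
    show x + 1 + 2 * (y + 1) + 2 * (n + 1) + 3 = x + 2 * y + 2 * n + 8 by omega,
    show x + 1 + 2 * n + 2 = x + 2 * n + 3 by omega,
    show y + 1 + 2 * n + 2 = y + 2 * n + 3 by omega,
    show x + 1 + 2 * (n + 1) + 2 = x + 2 * n + 5 by omega,
    show y + 1 + 2 * (n + 1) + 2 = y + 2 * n + 5 by omega]
  push_cast
  ring

theorem prod_detFactor_mul_prod_detFactor (x y n : ℕ) :
    (∏ i ∈ range (n + 1), detFactor (x + y + 2) (x + 3) y i) *
        ∏ i ∈ range (n + 1), detFactor (x + y + 2) x (y + 3) i =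
      condensationRatio (x + y + 1) (x + 1) (y + 1) n *
        ((∏ i ∈ range (n + 1), detFactor (x + y + 1) (x + 1) (y + 1) i) *
          ∏ i ∈ range n, detFactor (x + y + 3) (x + 2) (y + 2) i) := by
  induction n with
  | zero =>
    simp only [zero_add, prod_range_one, prod_range_zero, mul_one, detFactor, condensationRatio,
      asc, mul_zero, add_zero]
    simp only [Nat.factorial_succ]
    push_cast
    field_simp
  | succ n ih =>
    rw [prod_range_succ _ (n + 1), prod_range_succ _ (n + 1), prod_range_succ _ (n + 1),
      prod_range_succ (fun i => detFactor (x + y + 3) (x + 2) (y + 2) i) n, mul_mul_mul_comm, ih]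
    linear_combination
      ((∏ i ∈ range (n + 1), detFactor (x + y + 1) (x + 1) (y + 1) i) *
        ∏ i ∈ range n, detFactor (x + y + 3) (x + 2) (y + 2) i) *
      detFactor_mul_condensationRatio x y n

theorem det_factorialMatrix (n : ℕ) : ∀ {s x y : ℕ}, s + 1 = x + y →
    (factorialMatrix n s x y).det = ∏ i ∈ range n, detFactor s x y i := by
  induction n using Nat.twoStepInduction with
  | zero => simp
  | one =>
    intro s x y _
    simp [factorialMatrix, detFactor, asc, invFactorial_natCast]
    ring
  | more n ih₀ ih₁ =>
    intro s x y h
    have hcond := det_factorialMatrix_condensation n s x y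
    have hx : ((x : ℤ) + 1) = (x + 1 : ℕ) := by simp
    have hy : ((y : ℤ) + 1) = (y + 1 : ℕ) := by simp
    rw [hx, hy, ih₀ (by omega), ih₁ (by omega), ih₁ h] at hcond
    have hpos : (∏ i ∈ range n, detFactor (s + 2) (x + 1) (y + 1) i) ≠ 0 :=
      prod_ne_zero_iff.mpr fun i _ => (detFactor_pos (by omega) i).ne'
    have hoff : (factorialMatrix (n + 1) (s + 1) (x + 2) (y - 1)).det *
        (factorialMatrix (n + 1) (s + 1) (x - 1) (y + 2)).det =
        condensationRatio s x y n * ((∏ i ∈ range (n + 1), detFactor s x y i) *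
          ∏ i ∈ range n, detFactor (s + 2) (x + 1) (y + 1) i) := by
      rcases x with _ | x
      · simp [det_factorialMatrix_neg_one_left, condensationRatio]
      rcases y with _ | y
      · simp [det_factorialMatrix_neg_one_right, condensationRatio]
      obtain rfl : s = x + y + 1 := by omega
      rw [show ((x + 1 : ℕ) : ℤ) + 2 = (x + 3 : ℕ) by push_cast; ring,
        show ((y + 1 : ℕ) : ℤ) - 1 = y by simp, show ((x + 1 : ℕ) : ℤ) - 1 = x by simp,
        show ((y + 1 : ℕ) : ℤ) + 2 = (y + 3 : ℕ) by push_cast; ring,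
        ih₁ (by omega), ih₁ (by omega)]
      exact prod_detFactor_mul_prod_detFactor x y n
    rw [hoff, ← detFactor_sub_detFactor h,
      prod_range_succ (fun i => detFactor (s + 2) (x + 1) (y + 1) i)] at hcond
    apply mul_right_cancel₀ hpos
    rw [hcond, prod_range_succ _ (n + 1)]
    ring

theorem C_add_C_eq (x i j : ℕ) :
    C (x + i + j + 1) (2 * (i : ℤ) - j) + C (x + i + j) (2 * (i : ℤ) - j - 1) =
      ((x : ℚ) + 3 * i + 1) * (((x + i + j : ℕ).factorial : ℚ) *
        invFactorial (0 + 2 * (i : ℤ) - j) * invFactorial ((x + 1 : ℕ) + 2 * (j : ℤ) - i)) := by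
  rcases lt_or_ge (2 * i) j with hij | hij
  · rw [invFactorial_of_neg (k := 0 + 2 * (i : ℤ) - j) (by omega), C, C, if_neg (by omega),
      if_neg (by omega)]
    simp
  obtain ⟨k, hk⟩ := Nat.exists_eq_add_of_le hij
  rw [show 2 * (i : ℤ) - j = k by omega, show 0 + 2 * (i : ℤ) - j = k by omega,
    invFactorial_natCast]
  rcases lt_or_ge (x + i + j + 1) k with hlt | hge
  · rw [invFactorial_of_neg (by omega), C, C, if_pos (by omega), if_pos (by omega),
      Nat.choose_eq_zero_of_lt (by omega), Nat.choose_eq_zero_of_lt (by omega)]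
    simp
  obtain ⟨l, hl⟩ := Nat.exists_eq_add_of_le hge
  have hx : (x : ℚ) + 3 * i + 1 = k + (k + l) := by
    have : x + 3 * i + 1 = k + (k + l) := by omega
    exact_mod_cast this
  rw [show ((x + 1 : ℕ) : ℤ) + 2 * (j : ℤ) - i = l by omega, invFactorial_natCast, hx]
  rcases k with _ | k
  · obtain rfl : l = x + i + j + 1 := by omega
    simp [C, Nat.factorial_succ]
    field_simp
  · have hm : x + i + j = k + l := by omega
    rw [hm, C, C, if_pos (by omega), if_pos (by omega), Int.toNat_natCast,
      show (((k + 1 : ℕ) : ℤ) - 1).toNat = k by omega, show k + l + 1 = k + 1 + l by ring,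
      Nat.cast_add_choose, Nat.cast_add_choose, show k + 1 + l = k + l + 1 by ring,
      Nat.factorial_succ, Nat.factorial_succ]
    push_cast
    field_simp
    ring

theorem det_w (n x : ℕ) :
    Matrix.det (fun i j : Fin n =>
        C (x + (i : ℕ) + (j : ℕ) + 1) (2 * (i : ℤ) - (j : ℤ)) +
          C (x + (i : ℕ) + (j : ℕ)) (2 * (i : ℤ) - (j : ℤ) - 1)) =
      (∏ i ∈ Finset.range n, ((x : ℚ) + 3 * i + 1)) *
        ∏ i ∈ Finset.range n,
          ((i.factorial : ℚ) * ((x + i).factorial : ℚ) *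
              asc (2 * x + 2 * i + 2) i * asc (x + 2 * i + 1) i) /
            (((x + 2 * i + 1).factorial : ℚ) * ((2 * i).factorial : ℚ)) := by
  have hrow : Matrix.det (fun i j : Fin n =>
      C (x + (i : ℕ) + (j : ℕ) + 1) (2 * (i : ℤ) - (j : ℤ)) +
        C (x + (i : ℕ) + (j : ℕ)) (2 * (i : ℤ) - (j : ℤ) - 1)) =
      Matrix.det (Matrix.of fun i j : Fin n =>
        ((x : ℚ) + 3 * (i : ℕ) + 1) * factorialMatrix n x (0 : ℕ) (x + 1 : ℕ) i j) := by
    congr 1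
    ext i j
    exact C_add_C_eq x i j
  rw [hrow, Matrix.det_mul_column, Fin.prod_univ_eq_prod_range fun i : ℕ => (x : ℚ) + 3 * i + 1,
    det_factorialMatrix n (by omega)]
  congr 1
  refine prod_congr rfl fun i _ => ?_
  rw [detFactor_eq (p := x + i) (a := x + 2 * i + 1) (b := 2 * x + 2 * i + 2) (u := 2 * i)
    (v := x + 2 * i + 1) (by omega) (by omega) (by omega) (by omega) (by omega)]
  ring
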